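/- Define J_BS near k = 0 via β(k) solving sinh(β)/β = 1 + k for k > 0 (and analytically continued through k = 0). Then J_BS(1+k) = (3/2)k² - (9/5)k³ + (333/175)k⁴ - (1704/875)k⁵ + O(k⁶) as k → 0. -/

import Mathlib

open Real Filter Asymptotics

theorem exists_sinh_eq_taylor {b : ℝ} (hb : |b| ≤ 1) :
    ∃ e : ℝ, |e| ≤ 1 ∧ sinh b =
      b * (1 + b ^ 2 / 6 + b ^ 4 / 120 + b ^ 6 / 5040 + b ^ 8 / 362880 + e * b ^ 10) := by
  have h1 := exp_bound hb (n := 11) (by norm_num)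
  have h2 := exp_bound (x := -b) (by rwa [abs_neg]) (n := 11) (by norm_num)
  rw [abs_neg] at h2
  have hp : 0 ≤ |b| ^ 11 := by positivity
  have key : |sinh b - b * (1 + b ^ 2 / 6 + b ^ 4 / 120 + b ^ 6 / 5040 + b ^ 8 / 362880)|
      ≤ |b ^ 11| := by
    rw [abs_pow, sinh_eq]
    simp only [Finset.sum_range_succ, Finset.sum_range_zero, Nat.factorial, Nat.succ_eq_add_one]
      at h1 h2
    push_cast at h1 h2
    rw [abs_le] at h1 h2 ⊢
    constructor <;> linarith [h1.1, h1.2, h2.1, h2.2]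
  rcases eq_or_ne b 0 with rfl | hb0
  · exact ⟨0, by simp, by simp⟩
  · have hb11 : b ^ 11 ≠ 0 := pow_ne_zero _ hb0
    refine ⟨(sinh b - b * (1 + b ^ 2 / 6 + b ^ 4 / 120 + b ^ 6 / 5040 + b ^ 8 / 362880)) / b ^ 11,
      ?_, ?_⟩
    · rw [abs_div]
      exact div_le_one_of_le₀ key (abs_nonneg _)
    · field_simp
      ring

theorem exists_cosh_eq_taylor {b : ℝ} (hb : |b| ≤ 1) :
    ∃ e : ℝ, |e| ≤ 1 ∧ cosh b =
      1 + b ^ 2 / 2 + b ^ 4 / 24 + b ^ 6 / 720 + b ^ 8 / 40320 + b ^ 10 / 3628800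
        + e * b ^ 12 := by
  have h1 := exp_bound hb (n := 12) (by norm_num)
  have h2 := exp_bound (x := -b) (by rwa [abs_neg]) (n := 12) (by norm_num)
  rw [abs_neg] at h2
  have hp : 0 ≤ |b| ^ 12 := by positivity
  have key : |cosh b - (1 + b ^ 2 / 2 + b ^ 4 / 24 + b ^ 6 / 720 + b ^ 8 / 40320
      + b ^ 10 / 3628800)| ≤ |b ^ 12| := by
    rw [abs_pow, cosh_eq]
    simp only [Finset.sum_range_succ, Finset.sum_range_zero, Nat.factorial, Nat.succ_eq_add_one]
      at h1 h2
    push_cast at h1 h2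
    rw [abs_le] at h1 h2 ⊢
    constructor <;> linarith [h1.1, h1.2, h2.1, h2.2]
  rcases eq_or_ne b 0 with rfl | hb0
  · exact ⟨0, by simp, by simp⟩
  · have hb12 : b ^ 12 ≠ 0 := pow_ne_zero _ hb0
    refine ⟨(cosh b - (1 + b ^ 2 / 2 + b ^ 4 / 24 + b ^ 6 / 720 + b ^ 8 / 40320
      + b ^ 10 / 3628800)) / b ^ 12, ?_, ?_⟩
    · rw [abs_div]
      exact div_le_one_of_le₀ key (abs_nonneg _)
    · field_simp
      ring

theorem mul_one_add_sq_div_le_sinh {b : ℝ} (hb : 0 ≤ b) : b * (1 + b ^ 2 / 8) ≤ sinh b := by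
  have hs : b / 4 ≤ sinh (b / 4) := self_le_sinh_iff.2 (by positivity)
  have hs2 : b / 2 ≤ sinh (b / 2) := self_le_sinh_iff.2 (by positivity)
  have hc : 1 + b ^ 2 / 8 ≤ cosh (b / 2) := by
    have h := cosh_two_mul (b / 4)
    rw [show 2 * (b / 4) = b / 2 by ring, cosh_sq] at h
    nlinarith
  have h := sinh_two_mul (b / 2)
  rw [show 2 * (b / 2) = b by ring] at h
  rw [h]
  nlinarith [mul_le_mul hs2 hc (by positivity) (by linarith)]

theorem tanh_half_eq {b : ℝ} (hb : 0 < b) :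
    tanh (b / 2) = (cosh b - 1) / sinh b := by
  have hs : 0 < sinh (b / 2) := sinh_pos_iff.2 (by positivity)
  have hc : 0 < cosh (b / 2) := cosh_pos _
  have h1 := sinh_two_mul (b / 2)
  have h2 := cosh_two_mul (b / 2)
  rw [show 2 * (b / 2) = b by ring] at h1 h2
  rw [h1, h2, tanh_eq_sinh_div_cosh, cosh_sq]
  field_simp
  ring

theorem exists_bound_of_taylor_remainders : ∃ M : ℝ, ∀ u e e' k c : ℝ,
    0 ≤ u → u ≤ 1 → |e| ≤ 1 → |e'| ≤ 1 →
    k = u / 6 + u ^ 2 / 120 + u ^ 3 / 5040 + u ^ 4 / 362880 + e * u ^ 5 →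
    c = 1 + u / 2 + u ^ 2 / 24 + u ^ 3 / 720 + u ^ 4 / 40320 + u ^ 5 / 3628800 + e' * u ^ 6 →
    |(1 + k) * (u / 2 - ((3/2) * k ^ 2 - (9/5) * k ^ 3 + (333/175) * k ^ 4 - (1704/875) * k ^ 5))
      - (c - 1)| ≤ M * u ^ 6 := by
  let w : ℝ → ℝ := fun u => 1 / 6 + u / 120 + u ^ 2 / 5040 + u ^ 3 / 362880
  let a : ℝ → ℝ → ℝ := fun u e => w u + e * u ^ 4
  let R : ℝ × ℝ × ℝ → ℝ := fun p =>
    let u := p.1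
    let e := p.2.1
    let w := w u
    let a := a u e
    e / 2 - p.2.2
      - e * ((3/2) * (a + w) - (3/10) * u * (a ^ 2 + a * w + w ^ 2)
        + (18/175) * u ^ 2 * (a ^ 3 + a ^ 2 * w + a * w ^ 2 + w ^ 3)
        - (39/875) * u ^ 3 * (a ^ 4 + a ^ 3 * w + a ^ 2 * w ^ 2 + a * w ^ 3 + w ^ 4)
        - (1704/875) * u ^ 4
          * (a ^ 5 + a ^ 4 * w + a ^ 3 * w ^ 2 + a ^ 2 * w ^ 3 + a * w ^ 4 + w ^ 5))
      + ((321701/7620480000) + (961811/76204800000) * u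
        + (719632063/384072192000000) * u ^ 2 + (47044493/256048128000000) * u ^ 3
        + (21494542807/1613103206400000000) * u ^ 4 + (22008668351/29035857715200000000) * u ^ 5
        + (853867494077/24390120480768000000000) * u ^ 6 + (8178513109/6097530120192000000000) * u ^ 7
        + (1185200609/27438885540864000000000) * u ^ 8 + (542979973/460973277086515200000000) * u ^ 9
        + (160934603/5900457946707394560000000) * u ^ 10 + (2843528183/5310412152036655104000000000) * u ^ 11
        + (1317213677/148691540257026342912000000000) * u ^ 12 + (108911731/892149241542158057472000000000) * u ^ 13
        + (17656939/12846949078207076027596800000000) * u ^ 14 + (19667/1605868634775884503449600000000) * u ^ 15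
        + (2627/32117372695517690068992000000000) * u ^ 16 + (71/192704236173106140413952000000000) * u ^ 17
        + (71/83248230026781852658827264000000000) * u ^ 18)
  have hR : Continuous R := by fun_prop
  obtain ⟨M, hM⟩ := ((isCompact_Icc (a := (0 : ℝ)) (b := 1)).prod
    ((isCompact_Icc (a := (-1 : ℝ)) (b := 1)).prod
      (isCompact_Icc (a := (-1 : ℝ)) (b := 1)))).exists_bound_of_continuousOn hR.continuousOn
  refine ⟨M, fun u e e' k c hu0 hu1 he he' hk hc => ?_⟩
  have hb := hM (u, e, e') ⟨⟨hu0, hu1⟩, abs_le.1 he, abs_le.1 he'⟩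
  rw [Real.norm_eq_abs] at hb
  have hN : (1 + k) * (u / 2 - ((3/2) * k ^ 2 - (9/5) * k ^ 3 + (333/175) * k ^ 4
      - (1704/875) * k ^ 5)) - (c - 1) = R (u, e, e') * u ^ 6 := by
    subst hk hc
    simp only [R, a, w]
    ring
  rw [hN, abs_mul, abs_of_nonneg (pow_nonneg hu0 6)]
  exact mul_le_mul_of_nonneg_right hb (pow_nonneg hu0 6)

/-- ATM Taylor expansion of the Black–Scholes rate function: with `β(k) > 0` solving
`sinh(β)/β = 1 + k` for small `k > 0`,
`J_BS(1+k) = β²/2 - β tanh(β/2) = (3/2)k² - (9/5)k³ + (333/175)k⁴ - (1704/875)k⁵ + O(k⁶)`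
as `k → 0⁺`. -/
theorem stmt15 (β : ℝ → ℝ)
    (hβpos : ∀ᶠ k in nhdsWithin 0 (Set.Ioi 0), 0 < β k)
    (hβeq : ∀ᶠ k in nhdsWithin 0 (Set.Ioi 0), Real.sinh (β k) / β k = 1 + k) :
    (fun k => (β k) ^ 2 / 2 - β k * Real.tanh (β k / 2)
        - ((3/2) * k ^ 2 - (9/5) * k ^ 3 + (333/175) * k ^ 4 - (1704/875) * k ^ 5))
      =O[nhdsWithin 0 (Set.Ioi 0)] (fun k => k ^ 6) := by
  obtain ⟨M, hM⟩ := exists_bound_of_taylor_remainders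
  refine IsBigO.of_bound (max M 0 * 8 ^ 6) ?_
  have hsmall : ∀ᶠ k : ℝ in nhdsWithin 0 (Set.Ioi 0), k < 1 / 8 :=
    nhdsWithin_le_nhds (Iio_mem_nhds (by norm_num))
  filter_upwards [hβpos, hβeq, hsmall, self_mem_nhdsWithin] with k hb heq hk8 hk
  have hk0 : 0 < k := hk
  generalize β k = b at hb heq
  have hsinh : sinh b = b * (1 + k) := by
    rw [div_eq_iff hb.ne'] at heq
    rw [heq, mul_comm]
  have hu8 : b ^ 2 ≤ 8 * k := by
    have h := mul_one_add_sq_div_le_sinh hb.le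
    rw [hsinh] at h
    linarith [le_of_mul_le_mul_left h hb]
  have hu1 : b ^ 2 ≤ 1 := by linarith
  have hb1 : |b| ≤ 1 := (sq_le_one_iff_abs_le_one b).1 hu1
  obtain ⟨e, he, hse⟩ := exists_sinh_eq_taylor hb1
  obtain ⟨e', he', hce⟩ := exists_cosh_eq_taylor hb1
  have hkeq : 1 + k = _ := mul_left_cancel₀ hb.ne' (hsinh.symm.trans hse)
  have hN := hM (b ^ 2) e e' k (cosh b) (sq_nonneg b) hu1 he he' (by linear_combination hkeq)
    (by linear_combination hce)
  have hJ : b ^ 2 / 2 - b * tanh (b / 2)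
        - ((3/2) * k ^ 2 - (9/5) * k ^ 3 + (333/175) * k ^ 4 - (1704/875) * k ^ 5)
      = ((1 + k) * (b ^ 2 / 2 - ((3/2) * k ^ 2 - (9/5) * k ^ 3 + (333/175) * k ^ 4
        - (1704/875) * k ^ 5)) - (cosh b - 1)) / (1 + k) := by
    rw [tanh_half_eq hb, hsinh]
    field_simp
    ring
  rw [hJ, Real.norm_eq_abs, Real.norm_eq_abs, abs_div, abs_of_pos (show 0 < 1 + k by linarith),
    abs_of_pos (pow_pos hk0 6)]
  calc _ ≤ |(1 + k) * (b ^ 2 / 2 - ((3/2) * k ^ 2 - (9/5) * k ^ 3 + (333/175) * k ^ 4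
        - (1704/875) * k ^ 5)) - (cosh b - 1)| := div_le_self (abs_nonneg _) (by linarith)
    _ ≤ M * (b ^ 2) ^ 6 := hN
    _ ≤ max M 0 * (8 * k) ^ 6 := by
      gcongr
      exact le_max_left _ _
    _ = max M 0 * 8 ^ 6 * k ^ 6 := by ring
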